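/- arXiv:1608.04750 — 2 statements merged into one kernel-verified Lean document; each statement's English description precedes it below -/
import Mathlib

section
/- For every odd integer d, let U_S be the maximally I₃-scrambling unitary on ℂ^d⊗ℂ^d defined by U_S|i⟩|j⟩ = |i+j mod d⟩|i−j mod d⟩. Then its square acts as U_S²|i⟩|j⟩ = |2i mod d⟩|2j mod d⟩, a tensor product of local unitaries, and hence U_S² is minimally I₃-scrambling: I₃(A;C;D)_{U_S²} = 0. -/
open Matrix Kronecker Filter
open scoped BigOperators Classical ComplexOrder

noncomputable section

namespace Scrambling

/-- The maximally mixed state on a finite-dimensional system `X`. -/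
def mmState (X : Type*) [Fintype X] [DecidableEq X] : Matrix X X ℂ :=
  (Fintype.card X : ℂ)⁻¹ • 1

/-- A (possibly rectangular) matrix is unitary if `U Uᴴ = 1` and `Uᴴ U = 1`. -/
def IsUnitaryMat {m n : Type*} [Fintype m] [Fintype n] [DecidableEq m] [DecidableEq n]
    (U : Matrix m n ℂ) : Prop :=
  U * Uᴴ = 1 ∧ Uᴴ * U = 1

/-- Reduced density matrix of a pure state `ψ` on `X ⊗ Y`, tracing out `Y`. -/
def redDM {X Y : Type*} [Fintype Y] (ψ : X × Y → ℂ) : Matrix X X ℂ :=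
  Matrix.of fun x x' => ∑ y, ψ (x, y) * star (ψ (x', y))

/-- Base-2 von Neumann entropy of a (Hermitian) matrix: `S(ρ) = -tr (ρ log₂ ρ)`,
computed via the eigenvalues. Junk value `0` for non-Hermitian matrices. -/
def vNE {n : Type*} [Fintype n] [DecidableEq n] (ρ : Matrix n n ℂ) : ℝ :=
  if h : ρ.IsHermitian then (∑ i, Real.negMulLog (h.eigenvalues i)) / Real.log 2 else 0

/-- Trace norm `‖X‖₁ = tr √(XᴴX)`, via the eigenvalues of `XᴴX`. -/
def traceNorm {n : Type*} [Fintype n] [DecidableEq n] (X : Matrix n n ℂ) : ℝ :=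
  ∑ i, Real.sqrt ((Matrix.posSemidef_conjTranspose_mul_self X).1.eigenvalues i)

/-- Density matrix: positive semidefinite with unit trace. -/
def IsDensityMatrix {n : Type*} [Fintype n] (ρ : Matrix n n ℂ) : Prop :=
  ρ.PosSemidef ∧ ρ.trace = 1

/-- The pure density matrix `|ψ⟩⟨ψ|` associated to a state vector. -/
def pureDM {T : Type*} (ψ : T → ℂ) : Matrix T T ℂ :=
  Matrix.of fun x y => ψ x * star (ψ y)

/-- Extension `id_R ⊗ Φ` of a (linear) map `Φ` on matrices to a reference system `R`. -/
def extendCh {R A C : Type*} (Φ : Matrix A A ℂ → Matrix C C ℂ)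
    (ρ : Matrix (R × A) (R × A) ℂ) : Matrix (R × C) (R × C) ℂ :=
  Matrix.of fun p q => Φ (Matrix.of fun x y => ρ (p.1, x) (q.1, y)) p.2 q.2

/-- Diamond-norm distance between two (linear) maps on matrices:
the supremum over all finite-dimensional reference systems `R = Fin n` and all density
matrices `ρ` on `R ⊗ A` of the trace norm of the difference of the extended outputs. -/
def diamondDist {A C : Type*} [Fintype A] [DecidableEq A] [Fintype C] [DecidableEq C]
    (Φ Ψ : Matrix A A ℂ → Matrix C C ℂ) : ℝ :=
  sSup {x | ∃ (n : ℕ) (ρ : Matrix (Fin n × A) (Fin n × A) ℂ),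
    IsDensityMatrix ρ ∧ x = traceNorm (extendCh Φ ρ - extendCh Ψ ρ)}

/-- The unitary quantum channel `σ ↦ U σ Uᴴ`. -/
def uChannel {m n : Type*} [Fintype m] [Fintype n] (U : Matrix m n ℂ) : Matrix n n ℂ → Matrix m m ℂ :=
  fun σ => U * σ * Uᴴ

/-- The completely depolarizing channel `σ ↦ tr(σ) · τ_C`. -/
def depol (A C : Type*) [Fintype A] [Fintype C] [DecidableEq C] :
    Matrix A A ℂ → Matrix C C ℂ :=
  fun σ => σ.trace • mmState C

section FourParty

variable {A B C D : Type*} [Fintype A] [Fintype B] [Fintype C] [Fintype D]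
  [DecidableEq A] [DecidableEq B] [DecidableEq C] [DecidableEq D]

/-- State vector of the Choi state of a bipartite unitary `U : AB → CD`:
`|U⟩ = (1 ⊗ U)(|Φ⁺⟩_{AA'} ⊗ |Φ⁺⟩_{BB'})`. -/
def choiVec (U : Matrix (C × D) (A × B) ℂ) : (A × B) × C × D → ℂ :=
  fun p => (Real.sqrt (Fintype.card A * Fintype.card B) : ℂ)⁻¹ * U p.2 p.1

/-- Density matrix of the Choi state of a bipartite unitary. -/
def choiDM (U : Matrix (C × D) (A × B) ℂ) :
    Matrix ((A × B) × C × D) ((A × B) × C × D) ℂ :=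
  pureDM (choiVec U)

variable (ψ : (A × B) × C × D → ℂ)

/-- Reduced density matrices of a four-party pure state on `A ⊗ B ⊗ C ⊗ D`. -/
def rhoA : Matrix A A ℂ :=
  redDM fun p : A × (B × C × D) => ψ ((p.1, p.2.1), (p.2.2.1, p.2.2.2))

def rhoB : Matrix B B ℂ :=
  redDM fun p : B × (A × C × D) => ψ ((p.2.1, p.1), (p.2.2.1, p.2.2.2))

def rhoC : Matrix C C ℂ :=
  redDM fun p : C × (A × B × D) => ψ ((p.2.1, p.2.2.1), (p.1, p.2.2.2))

def rhoD : Matrix D D ℂ :=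
  redDM fun p : D × (A × B × C) => ψ ((p.2.1, p.2.2.1), (p.2.2.2, p.1))

def rhoAB : Matrix (A × B) (A × B) ℂ := redDM ψ

def rhoAC : Matrix (A × C) (A × C) ℂ :=
  redDM fun p : (A × C) × B × D => ψ ((p.1.1, p.2.1), (p.1.2, p.2.2))

def rhoAD : Matrix (A × D) (A × D) ℂ :=
  redDM fun p : (A × D) × B × C => ψ ((p.1.1, p.2.1), (p.2.2, p.1.2))

def rhoBC : Matrix (B × C) (B × C) ℂ :=
  redDM fun p : (B × C) × A × D => ψ ((p.2.1, p.1.1), (p.1.2, p.2.2))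

def rhoBD : Matrix (B × D) (B × D) ℂ :=
  redDM fun p : (B × D) × A × C => ψ ((p.2.1, p.1.1), (p.2.2, p.1.2))

def rhoCD : Matrix (C × D) (C × D) ℂ :=
  redDM fun p : (C × D) × A × B => ψ (p.2, p.1)

def rhoABC : Matrix ((A × B) × C) ((A × B) × C) ℂ :=
  redDM fun p : ((A × B) × C) × D => ψ (p.1.1, (p.1.2, p.2))

def rhoABD : Matrix ((A × B) × D) ((A × B) × D) ℂ :=
  redDM fun p : ((A × B) × D) × C => ψ (p.1.1, (p.2, p.1.2))

def rhoACD : Matrix (A × C × D) (A × C × D) ℂ :=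
  redDM fun p : (A × C × D) × B => ψ ((p.1.1, p.2), p.1.2)

def rhoBCD : Matrix (B × C × D) (B × C × D) ℂ :=
  redDM fun p : (B × C × D) × A => ψ ((p.2, p.1.1), p.1.2)

/-- Subsystem von Neumann entropies. -/
def SA : ℝ := vNE (rhoA ψ)
def SB : ℝ := vNE (rhoB ψ)
def SC : ℝ := vNE (rhoC ψ)
def SD : ℝ := vNE (rhoD ψ)
def SAB : ℝ := vNE (rhoAB ψ)
def SAC : ℝ := vNE (rhoAC ψ)
def SAD : ℝ := vNE (rhoAD ψ)
def SBC : ℝ := vNE (rhoBC ψ)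
def SBD : ℝ := vNE (rhoBD ψ)
def SCD : ℝ := vNE (rhoCD ψ)
def SABC : ℝ := vNE (rhoABC ψ)
def SABD : ℝ := vNE (rhoABD ψ)
def SACD : ℝ := vNE (rhoACD ψ)
def SBCD : ℝ := vNE (rhoBCD ψ)

/-- Mutual informations `I(X;Y) = S(X) + S(Y) - S(XY)`. -/
def IAB : ℝ := SA ψ + SB ψ - SAB ψ
def IAC : ℝ := SA ψ + SC ψ - SAC ψ
def IAD : ℝ := SA ψ + SD ψ - SAD ψ
def IBC : ℝ := SB ψ + SC ψ - SBC ψ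
def IBD : ℝ := SB ψ + SD ψ - SBD ψ
def ICD : ℝ := SC ψ + SD ψ - SCD ψ
def IACD : ℝ := SA ψ + SCD ψ - SACD ψ

/-- Tripartite information `I₃(A;C;D) = I(A;C) + I(A;D) - I(A;CD)`. -/
def I3ACD : ℝ := IAC ψ + IAD ψ - IACD ψ

/-- Conditional mutual informations. -/
def cmiAB_C : ℝ := SAC ψ + SBC ψ - SC ψ - SABC ψ
def cmiAB_D : ℝ := SAD ψ + SBD ψ - SD ψ - SABD ψ
def cmiCD_A : ℝ := SAC ψ + SAD ψ - SA ψ - SACD ψ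
def cmiCD_B : ℝ := SBC ψ + SBD ψ - SB ψ - SBCD ψ

/-- Rényi-2 entropy `S₂(ρ) = -log₂ tr ρ²`. -/
def S2 {n : Type*} [Fintype n] (ρ : Matrix n n ℂ) : ℝ :=
  -Real.logb 2 ((ρ * ρ).trace.re)

/-- Rényi-2 tripartite information `I₃⁽²⁾ = S₂(A) + S₂(B) - S₂(AC) - S₂(AD)`. -/
def I3r2 : ℝ := S2 (rhoA ψ) + S2 (rhoB ψ) - S2 (rhoAC ψ) - S2 (rhoAD ψ)

end FourParty

/-- The residual channel `N_{A→C}(σ) = tr_D [U (σ ⊗ τ_B) Uᴴ]`. -/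
def residual {A B C D : Type*} [Fintype A] [Fintype B] [Fintype C] [Fintype D]
    [DecidableEq A] [DecidableEq B]
    (U : Matrix (C × D) (A × B) ℂ) (σ : Matrix A A ℂ) : Matrix C C ℂ :=
  Matrix.of fun c c' => ∑ d, (U * (σ ⊗ₖ mmState B) * Uᴴ) (c, d) (c', d)

/-- A unitary on `X ⊗ X` is a perfect tensor iff all two-party marginals of its
Choi state are maximally mixed. -/
def PerfectTensor {X : Type*} [Fintype X] [DecidableEq X]
    (U : Matrix (X × X) (X × X) ℂ) : Prop :=
  rhoAB (choiVec U) = mmState (X × X) ∧ rhoAC (choiVec U) = mmState (X × X) ∧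
  rhoAD (choiVec U) = mmState (X × X) ∧ rhoBC (choiVec U) = mmState (X × X) ∧
  rhoBD (choiVec U) = mmState (X × X) ∧ rhoCD (choiVec U) = mmState (X × X)

/-- The unitary `U_d` which acts as `U_S` on the subspace spanned by the first `d_S`
basis vectors of each tensor factor, and as the identity otherwise. -/
def embedU (dS d : ℕ) (h : dS ≤ d) (US : Matrix (Fin dS × Fin dS) (Fin dS × Fin dS) ℂ) :
    Matrix (Fin d × Fin d) (Fin d × Fin d) ℂ :=
  Matrix.of fun o i =>
    if hi : i.1.val < dS ∧ i.2.val < dS then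
      if ho : o.1.val < dS ∧ o.2.val < dS then
        US (⟨o.1.val, ho.1⟩, ⟨o.2.val, ho.2⟩) (⟨i.1.val, hi.1⟩, ⟨i.2.val, hi.2⟩)
      else 0
    else if o = i then 1 else 0


/-- The bipartite unitary `U_S |i⟩|j⟩ = |i+j mod d⟩|i−j mod d⟩` on `ℂ^d ⊗ ℂ^d`. -/
def USadd (d : ℕ) : Matrix (Fin d × Fin d) (Fin d × Fin d) ℂ :=
  Matrix.of fun o i => if o.1 = i.1 + i.2 ∧ o.2 = i.1 - i.2 then 1 else 0

theorem vNE_of_sq {n : Type*} [Fintype n] [DecidableEq n] (ρ : Matrix n n ℂ) (c : ℝ)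
    (hH : ρ.IsHermitian) (hsq : ρ * ρ = (c : ℂ) • ρ) (htr : ρ.trace = 1) :
    vNE ρ = -Real.log c / Real.log 2 := by
  have key : ∀ i, hH.eigenvalues i = 0 ∨ hH.eigenvalues i = c := by
    intro i
    have h1 := hH.mulVec_eigenvectorBasis i
    set v : n → ℂ := (hH.eigenvectorBasis i).ofLp with hv
    set l := hH.eigenvalues i with hl
    have hv0 : v ≠ 0 := by
      intro h
      have h2 := hH.eigenvectorBasis.orthonormal.ne_zero i
      apply h2
      ext j
      exact congrFun h j
    have h3 : (ρ * ρ) *ᵥ v = l • l • v := by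
      rw [← Matrix.mulVec_mulVec, h1, Matrix.mulVec_smul, h1]
    rw [hsq, Matrix.smul_mulVec, h1] at h3
    obtain ⟨j, hj⟩ := Function.ne_iff.mp hv0
    have h4 := congrFun h3 j
    simp only [Pi.smul_apply, Complex.real_smul, smul_eq_mul] at h4
    have h5 : (l : ℂ) * ((c : ℂ) - l) * v j = 0 := by linear_combination h4
    have hj' : v j ≠ 0 := hj
    rcases mul_eq_zero.mp h5 with h6 | h6
    · rcases mul_eq_zero.mp h6 with h7 | h7
      · left; exact_mod_cast h7
      · right; exact_mod_cast (sub_eq_zero.mp h7).symm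
    · exact absurd h6 hj'
  have hs : ∑ i, hH.eigenvalues i = 1 := by
    have := hH.trace_eq_sum_eigenvalues
    rw [htr] at this
    have h2 : ((1 : ℝ) : ℂ) = ((∑ i, hH.eigenvalues i : ℝ) : ℂ) := by
      push_cast; exact this
    exact (Complex.ofReal_injective h2).symm
  have hsum : ∑ i, Real.negMulLog (hH.eigenvalues i) = -Real.log c := by
    have : ∀ i, Real.negMulLog (hH.eigenvalues i) = hH.eigenvalues i * (-Real.log c) := by
      intro i
      rcases key i with h | h <;> rw [h] <;> simp [Real.negMulLog]
    simp_rw [this]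
    rw [← Finset.sum_mul, hs, one_mul]
  unfold vNE
  rw [dif_pos hH, hsum]

theorem redDM_herm {X Y : Type*} [Fintype Y] (ψ : X × Y → ℂ) : (redDM ψ).IsHermitian := by
  ext x y
  simp [redDM, Matrix.conjTranspose_apply, mul_comm]

/-- Local permutation unitary. -/
def locU {X : Type*} [DecidableEq X] (e : X ≃ X) : Matrix (X × X) (X × X) ℂ :=
  Matrix.of fun o i => (if o.1 = e i.1 then 1 else 0) * (if o.2 = e i.2 then 1 else 0)

section loc
variable {X : Type*} [Fintype X] [DecidableEq X] [Nonempty X] (e : X ≃ X)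

theorem sqrt_card : ((Real.sqrt (Fintype.card X * Fintype.card X) : ℝ) : ℂ) = Fintype.card X := by
  rw [Real.sqrt_mul_self (by positivity)]; simp

theorem card_ne : (Fintype.card X : ℂ) ≠ 0 := by
  exact_mod_cast Fintype.card_ne_zero

theorem choi_loc (a b c d : X) : choiVec (locU e) ((a, b), (c, d)) =
    (Fintype.card X : ℂ)⁻¹ * ((if c = e a then 1 else 0) * (if d = e b then 1 else 0)) := by
  unfold choiVec
  rw [sqrt_card]; rfl

theorem sum_e (d : X) : (∑ b, if d = e b then (1 : ℂ) else 0) = 1 := by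
  rw [Equiv.sum_comp e (fun b => if d = b then (1 : ℂ) else 0)]; simp

theorem sum_ee (d d' : X) : (∑ b, (if d = e b then (1 : ℂ) else 0) * (if d' = e b then 1 else 0))
    = if d = d' then 1 else 0 := by
  rw [Equiv.sum_comp e (fun b => (if d = b then (1 : ℂ) else 0) * (if d' = b then 1 else 0))]
  simp [eq_comm]

theorem sum_dd (a a' : X) : (∑ c, (if c = e a then (1 : ℂ) else 0) * (if c = e a' then 1 else 0))
    = if a = a' then 1 else 0 := by
  by_cases h : a = a'
  · simp [h]
  · have h' : ¬ a' = a := fun q => h q.symm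
    simp [h, h']

theorem dbl_sum (f g : X → ℂ) : (∑ x, ∑ y, f y * g x) = (∑ x, f x) * ∑ x, g x := by
  rw [Finset.sum_comm, Finset.sum_mul_sum]

theorem star_d (p : Prop) [Decidable p] : star (if p then (1 : ℂ) else 0) = if p then 1 else 0 := by
  split_ifs <;> simp

theorem term_eq (a b c d a' b' c' d' : X) :
    choiVec (locU e) ((a, b), (c, d)) * star (choiVec (locU e) ((a', b'), (c', d'))) =
    (Fintype.card X : ℂ)⁻¹ * (Fintype.card X : ℂ)⁻¹ *
      (((if c = e a then 1 else 0) * (if c' = e a' then 1 else 0)) *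
      ((if d = e b then 1 else 0) * (if d' = e b' then 1 else 0))) := by
  rw [choi_loc, choi_loc, star_mul', star_mul', star_d, star_d, star_inv₀, star_natCast]
  ring

theorem rhoAC_loc (a c a' c' : X) : rhoAC (choiVec (locU e)) (a, c) (a', c') =
    (Fintype.card X : ℂ)⁻¹ * ((if c = e a then 1 else 0) * (if c' = e a' then 1 else 0)) := by
  have h := card_ne (X := X)
  simp only [rhoAC, redDM, Matrix.of_apply, Fintype.sum_prod_type, term_eq, ← Finset.mul_sum, sum_dd]
  simp

theorem rhoAD_loc (a c a' c' : X) : rhoAD (choiVec (locU e)) (a, c) (a', c') =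
    (Fintype.card X : ℂ)⁻¹ * (Fintype.card X : ℂ)⁻¹ *
      ((if a = a' then 1 else 0) * (if c = c' then 1 else 0)) := by
  simp only [rhoAD, redDM, Matrix.of_apply, Fintype.sum_prod_type, term_eq, ← Finset.mul_sum]
  rw [dbl_sum (fun y => (if y = e a then (1 : ℂ) else 0) * (if y = e a' then 1 else 0))
    (fun x => (if c = e x then (1 : ℂ) else 0) * (if c' = e x then 1 else 0)), sum_dd, sum_ee]

theorem rhoCD_loc (a c a' c' : X) : rhoCD (choiVec (locU e)) (a, c) (a', c') =
    (Fintype.card X : ℂ)⁻¹ * (Fintype.card X : ℂ)⁻¹ *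
      ((if a = a' then 1 else 0) * (if c = c' then 1 else 0)) := by
  simp only [rhoCD, redDM, Matrix.of_apply, Fintype.sum_prod_type, term_eq, ← Finset.mul_sum,
    ← Finset.sum_mul, sum_dd, sum_ee]

theorem rhoACD_loc (a c d a' c' d' : X) : rhoACD (choiVec (locU e)) (a, c, d) (a', c', d') =
    (Fintype.card X : ℂ)⁻¹ * (Fintype.card X : ℂ)⁻¹ *
      (((if c = e a then 1 else 0) * (if c' = e a' then 1 else 0)) * (if d = d' then 1 else 0)) := by
  simp only [rhoACD, redDM, Matrix.of_apply, term_eq, ← Finset.mul_sum, sum_ee]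

theorem rhoA_loc (a a' : X) : rhoA (choiVec (locU e)) a a' =
    (Fintype.card X : ℂ)⁻¹ * (if a = a' then 1 else 0) := by
  have h := card_ne (X := X)
  simp only [rhoA, redDM, Matrix.of_apply, Fintype.sum_prod_type, term_eq, ← Finset.mul_sum]
  have h2 : ∀ b : X, (∑ c, ∑ i, ((if c = e a then (1 : ℂ) else 0) * (if c = e a' then 1 else 0)) *
      ((if i = e b then (1:ℂ) else 0) * (if i = e b then 1 else 0))) =
      (if a = a' then 1 else 0) := by
    intro b
    rw [← Finset.sum_mul_sum, sum_dd, sum_dd, if_pos rfl, mul_one]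
  simp only [h2, Finset.sum_const, Finset.card_univ, nsmul_eq_mul]
  field_simp

theorem rhoC_loc (a a' : X) : rhoC (choiVec (locU e)) a a' =
    (Fintype.card X : ℂ)⁻¹ * (if a = a' then 1 else 0) := by
  have h := card_ne (X := X)
  simp only [rhoC, redDM, Matrix.of_apply, Fintype.sum_prod_type, term_eq, ← Finset.mul_sum]
  have h2 : ∀ x y : X, (∑ i, ((if a = e x then (1 : ℂ) else 0) * (if a' = e x then 1 else 0)) *
      ((if i = e y then (1:ℂ) else 0) * (if i = e y then 1 else 0))) =
      (if a = e x then (1 : ℂ) else 0) * (if a' = e x then 1 else 0) := by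
    intro x y
    rw [← Finset.mul_sum, sum_dd, if_pos rfl, mul_one]
  simp only [h2, Finset.sum_const, Finset.card_univ, nsmul_eq_mul]
  rw [← Finset.mul_sum, sum_ee]
  field_simp

theorem rhoD_loc (a a' : X) : rhoD (choiVec (locU e)) a a' =
    (Fintype.card X : ℂ)⁻¹ * (if a = a' then 1 else 0) := by
  have h := card_ne (X := X)
  simp only [rhoD, redDM, Matrix.of_apply, Fintype.sum_prod_type, term_eq, ← Finset.mul_sum]
  have h2 : ∀ x y : X, (∑ i, (if i = e x then (1:ℂ) else 0) * (if i = e x then 1 else 0) *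
      ((if a = e y then (1 : ℂ) else 0) * (if a' = e y then 1 else 0))) =
      (if a = e y then (1 : ℂ) else 0) * (if a' = e y then 1 else 0) := by
    intro x y
    rw [← Finset.sum_mul, sum_dd, if_pos rfl, one_mul]
  simp only [h2, sum_ee, Finset.sum_const, Finset.card_univ, nsmul_eq_mul]
  field_simp

theorem vNE_mm {Y : Type*} [Fintype Y] [DecidableEq Y] [Nonempty Y] (ρ : Matrix Y Y ℂ) (c : ℝ)
    (hc : c * Fintype.card Y = 1) (h : ρ = (c : ℂ) • 1) :
    vNE ρ = -Real.log c / Real.log 2 := by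
  subst h
  apply vNE_of_sq
  · unfold Matrix.IsHermitian; rw [Matrix.conjTranspose_smul, Matrix.conjTranspose_one]; simp
  · simp
  · simp only [Matrix.trace_smul, Matrix.trace_one, smul_eq_mul]
    exact_mod_cast hc

theorem card_neR : (Fintype.card X : ℝ) ≠ 0 := by
  exact_mod_cast Fintype.card_ne_zero

theorem I3_loc : I3ACD (choiVec (locU e)) = 0 := by
  have h := card_ne (X := X)
  have hR := card_neR (X := X)
  obtain ⟨N, hN⟩ : ∃ N : ℝ, N = (Fintype.card X : ℝ) := ⟨_, rfl⟩
  rw [← hN] at hR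
  have hi : N⁻¹ * (Fintype.card X : ℝ) = 1 := by rw [← hN]; exact inv_mul_cancel₀ hR
  have hA : SA (choiVec (locU e)) = Real.log N / Real.log 2 := by
    unfold SA
    rw [vNE_mm _ N⁻¹ hi, Real.log_inv, neg_neg]
    ext i j; rw [rhoA_loc]; simp [hN, Matrix.one_apply]
  have hC : SC (choiVec (locU e)) = Real.log N / Real.log 2 := by
    unfold SC
    rw [vNE_mm _ N⁻¹ hi, Real.log_inv, neg_neg]
    ext i j; rw [rhoC_loc]; simp [hN, Matrix.one_apply]
  have hD : SD (choiVec (locU e)) = Real.log N / Real.log 2 := by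
    unfold SD
    rw [vNE_mm _ N⁻¹ hi, Real.log_inv, neg_neg]
    ext i j; rw [rhoD_loc]; simp [hN, Matrix.one_apply]
  have hc2 : (N * N)⁻¹ * (Fintype.card (X × X) : ℝ) = 1 := by
    rw [Fintype.card_prod]; push_cast; rw [← hN]; field_simp
  have hCD : SCD (choiVec (locU e)) = 2 * Real.log N / Real.log 2 := by
    unfold SCD
    rw [vNE_mm _ (N * N)⁻¹ hc2, Real.log_inv, neg_neg, Real.log_mul hR hR, two_mul]
    ext ⟨i, i'⟩ ⟨j, j'⟩; rw [rhoCD_loc]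
    by_cases h1 : i = j <;> by_cases h2 : i' = j' <;> simp [hN, Matrix.one_apply, h1, h2]
  have hAD : SAD (choiVec (locU e)) = 2 * Real.log N / Real.log 2 := by
    unfold SAD
    rw [vNE_mm _ (N * N)⁻¹ hc2, Real.log_inv, neg_neg, Real.log_mul hR hR, two_mul]
    ext ⟨i, i'⟩ ⟨j, j'⟩; rw [rhoAD_loc]
    by_cases h1 : i = j <;> by_cases h2 : i' = j' <;> simp [hN, Matrix.one_apply, h1, h2]
  have hAC : SAC (choiVec (locU e)) = 0 := by
    unfold SAC
    rw [vNE_of_sq (rhoAC (choiVec (locU e))) 1 (redDM_herm _)]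
    · simp
    · ext ⟨i, i'⟩ ⟨j, j'⟩
      simp only [Matrix.mul_apply, Matrix.smul_apply, Fintype.sum_prod_type, rhoAC_loc]
      by_cases h1 : i' = e i <;> by_cases h2 : j' = e j <;> simp [h1, h2]
    · simp only [Matrix.trace, Matrix.diag, Fintype.sum_prod_type, rhoAC_loc]
      simp [h]
  have hACD : SACD (choiVec (locU e)) = Real.log N / Real.log 2 := by
    unfold SACD
    rw [vNE_of_sq (rhoACD (choiVec (locU e))) N⁻¹ (redDM_herm _), Real.log_inv, neg_neg]
    · ext ⟨i, i', i''⟩ ⟨j, j', j''⟩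
      simp only [Matrix.mul_apply, Matrix.smul_apply, Fintype.sum_prod_type, rhoACD_loc]
      by_cases h1 : i' = e i <;> by_cases h2 : j' = e j <;> by_cases h3 : i'' = j'' <;>
        simp [h1, h2, h3, hN]
      field_simp
    · simp only [Matrix.trace, Matrix.diag, Fintype.sum_prod_type, rhoACD_loc]
      simp [h]
  unfold I3ACD IAC IAD IACD
  rw [hA, hC, hD, hCD, hAD, hAC, hACD]
  ring

end loc

theorem dbl_inj (d : ℕ) (hd : Odd d) : Function.Injective (fun a : Fin d => a + a) := by
  intro a b hab
  have h := congrArg Fin.val hab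
  simp only [Fin.val_add, ← two_mul] at h
  have h2 : a.val ≡ b.val [MOD d] :=
    Nat.ModEq.cancel_left_of_coprime (c := 2) (by simpa using hd) h
  exact Fin.ext (Nat.ModEq.eq_of_lt_of_lt h2 a.2 b.2)

theorem USadd_sq (d : ℕ) (hd : Odd d) : USadd d * USadd d =
      Matrix.of (fun o i : Fin d × Fin d =>
        if o.1 = i.1 + i.1 ∧ o.2 = i.2 + i.2 then (1 : ℂ) else 0) := by
  have : NeZero d := ⟨by rintro rfl; simp at hd⟩
  ext o i
  have h1 : (i.1 + i.2) + (i.1 - i.2) = i.1 + i.1 := by abel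
  have h2 : (i.1 + i.2) - (i.1 - i.2) = i.2 + i.2 := by abel
  rw [Matrix.mul_apply, Finset.sum_eq_single (i.1 + i.2, i.1 - i.2)]
  · simp only [USadd, Matrix.of_apply, h1, h2]; simp
  · intro b _ hb
    have : ¬ (b.1 = i.1 + i.2 ∧ b.2 = i.1 - i.2) := fun h => hb (Prod.ext h.1 h.2)
    simp [USadd, this]
  · simp

/-- The square of `U_S : |i⟩|j⟩ ↦ |i+j⟩|i−j⟩` acts as the tensor product
of local unitaries `|i⟩|j⟩ ↦ |2i⟩|2j⟩`, and hence `U_S²` is minimally I₃-scrambling. -/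
theorem USadd_sq_minimally_scrambling (d : ℕ) (hd : Odd d) :
    USadd d * USadd d =
      Matrix.of (fun o i : Fin d × Fin d =>
        if o.1 = i.1 + i.1 ∧ o.2 = i.2 + i.2 then (1 : ℂ) else 0) ∧
    I3ACD (choiVec (USadd d * USadd d)) = 0 := by
  refine ⟨USadd_sq d hd, ?_⟩
  have : NeZero d := ⟨by rintro rfl; simp at hd⟩
  have : USadd d * USadd d =
      locU (Equiv.ofBijective _ (Finite.injective_iff_bijective.mp (dbl_inj d hd))) := by
    rw [USadd_sq d hd]
    ext o i
    simp only [locU, Matrix.of_apply, Equiv.ofBijective_apply]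
    by_cases h1 : o.1 = i.1 + i.1 <;> by_cases h2 : o.2 = i.2 + i.2 <;> simp [h1, h2]
  rw [this]
  exact I3_loc _

end Scrambling

end
end

section
/- Let U_{AB→CD} be a maximally I₃-scrambling bipartite unitary, and suppose that either A or C has the smallest dimension among the four subsystems. Then the reduced Choi state ρ_{AC} is maximally mixed and I(A;C) = 0. Consequently, the residual channel N_{A→C}(σ_A) = tr_D[U(σ_A ⊗ τ_B)U†] is completely depolarizing: N_{A→C}(σ_A) = τ_C for every input state σ_A. -/
open Matrix Kronecker Filter
open scoped BigOperators Classical ComplexOrder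

noncomputable section

namespace Scrambling

lemma nml_le (x : ℝ) (k : ℝ) (hk : 0 < k) (hx : 0 ≤ x) :
    Real.negMulLog x ≤ x * Real.log k + (k⁻¹ - x) := by
  rcases hx.eq_or_lt with rfl | hx
  · simp [hk.le]
  · have h := Real.log_le_sub_one_of_pos (x := (k * x)⁻¹) (by positivity)
    rw [Real.log_inv, Real.log_mul hk.ne' hx.ne'] at h
    have h2 := mul_le_mul_of_nonneg_left h hx.le
    have h3 : x * ((k * x)⁻¹ - 1) = k⁻¹ - x := by field_simp
    rw [h3] at h2
    unfold Real.negMulLog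
    linarith

lemma nml_lt (x : ℝ) (k : ℝ) (hk : 0 < k) (hx : 0 ≤ x) (hne : x ≠ k⁻¹) :
    Real.negMulLog x < x * Real.log k + (k⁻¹ - x) := by
  rcases hx.eq_or_lt with rfl | hx
  · simp [hk]
  · have h := Real.log_lt_sub_one_of_pos (x := (k * x)⁻¹) (by positivity) (by
      intro h
      apply hne
      rw [inv_eq_one] at h
      field_simp
      linarith)
    rw [Real.log_inv, Real.log_mul hk.ne' hx.ne'] at h
    have h2 := mul_lt_mul_of_pos_left h hx
    have h3 : x * ((k * x)⁻¹ - 1) = k⁻¹ - x := by field_simp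
    rw [h3] at h2
    unfold Real.negMulLog
    linarith

lemma sum_eig {n : Type*} [Fintype n] [DecidableEq n] {ρ : Matrix n n ℂ} (h : ρ.IsHermitian)
    (ht : ρ.trace = 1) : ∑ i, h.eigenvalues i = 1 := by
  have := h.trace_eq_sum_eigenvalues
  rw [ht] at this
  exact Complex.ofReal_injective (by push_cast; exact this.symm)

lemma vNE_le {n : Type*} [Fintype n] [DecidableEq n] {ρ : Matrix n n ℂ} (h : ρ.PosSemidef)
    (ht : ρ.trace = 1) (k : ℕ) (hk : 0 < k) (hr : ρ.rank ≤ k) :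
    vNE ρ ≤ Real.logb 2 k := by
  have hk' : (0:ℝ) < k := by exact_mod_cast hk
  rw [vNE, dif_pos h.1, Real.logb]
  apply div_le_div_of_nonneg_right _ (Real.log_nonneg (by norm_num))
  have h1 : ∀ i, Real.negMulLog (h.1.eigenvalues i) ≤
      h.1.eigenvalues i * Real.log k - h.1.eigenvalues i
        + if h.1.eigenvalues i ≠ 0 then (k:ℝ)⁻¹ else 0 := by
    intro i
    split_ifs with hi
    · have := nml_le _ k hk' (h.eigenvalues_nonneg i)
      linarith
    · push Not at hi
      simp [hi]
  refine (Finset.sum_le_sum fun i _ => h1 i).trans ?_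
  rw [Finset.sum_add_distrib, Finset.sum_sub_distrib, ← Finset.sum_mul, sum_eig h.1 ht,
    ← Finset.sum_filter, Finset.sum_const, nsmul_eq_mul]
  rw [h.1.rank_eq_card_non_zero_eigs, Fintype.card_subtype] at hr
  have : ((Finset.univ.filter fun i => h.1.eigenvalues i ≠ 0).card : ℝ) * (k:ℝ)⁻¹ ≤ 1 := by
    rw [← div_eq_mul_inv, div_le_one hk']
    exact_mod_cast hr
  linarith

lemma eq_mm_of_vNE {n : Type*} [Fintype n] [DecidableEq n] [Nonempty n] {ρ : Matrix n n ℂ}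
    (h : ρ.PosSemidef) (ht : ρ.trace = 1) (hr : Real.logb 2 (Fintype.card n) ≤ vNE ρ) :
    ρ = mmState n := by
  have hk' : (0:ℝ) < Fintype.card n := by exact_mod_cast Fintype.card_pos
  rw [vNE, dif_pos h.1, Real.logb, div_le_div_iff_of_pos_right (Real.log_pos (by norm_num))] at hr
  have key : ∀ i, h.1.eigenvalues i = (Fintype.card n : ℝ)⁻¹ := by
    by_contra! hc
    obtain ⟨i, hi⟩ := hc
    have := Finset.sum_lt_sum (s := Finset.univ)
      (fun j _ => nml_le _ _ hk' (h.eigenvalues_nonneg j))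
      ⟨i, Finset.mem_univ i, nml_lt _ _ hk' (h.eigenvalues_nonneg i) hi⟩
    rw [Finset.sum_add_distrib, Finset.sum_sub_distrib, ← Finset.sum_mul, sum_eig h.1 ht] at this
    simp at this
    linarith
  have hs := h.1.spectral_theorem
  have hd : (RCLike.ofReal ∘ h.1.eigenvalues : n → ℂ) = fun _ => ((Fintype.card n : ℂ))⁻¹ := by
    funext i; simp [key i]
  rw [hd] at hs
  rw [hs, mmState]
  have : (Matrix.diagonal fun _ : n => ((Fintype.card n : ℂ))⁻¹) = (Fintype.card n : ℂ)⁻¹ • (1 : Matrix n n ℂ) := by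
    rw [Matrix.smul_one_eq_diagonal]
  rw [this, map_smul, map_one]

lemma vNE_flat {n : Type*} [Fintype n] [DecidableEq n] {ρ : Matrix n n ℂ} (h : ρ.IsHermitian)
    (ht : ρ.trace = 1) (k : ℕ) (h2 : ρ * ρ = (k : ℂ)⁻¹ • ρ) :
    vNE ρ = Real.logb 2 k := by
  have key : ∀ i, h.eigenvalues i * h.eigenvalues i = (k:ℝ)⁻¹ * h.eigenvalues i := by
    intro i
    have hv := h.mulVec_eigenvectorBasis i
    have h3 := congrArg (fun M => M *ᵥ (h.eigenvectorBasis i).ofLp) h2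
    simp only [← Matrix.mulVec_mulVec, Matrix.smul_mulVec, hv, Matrix.mulVec_smul] at h3
    have hne : (h.eigenvectorBasis i).ofLp ≠ 0 := by
      intro h0
      have := h.eigenvectorBasis.orthonormal.ne_zero i
      apply this
      ext j
      simpa using congrFun h0 j
    obtain ⟨j, hj⟩ := Function.ne_iff.mp hne
    have h4 := congrFun h3 j
    simp only [Pi.smul_apply, smul_eq_mul, Complex.real_smul] at h4
    simp only [← mul_assoc] at h4
    have h5 := mul_right_cancel₀ hj h4
    exact Complex.ofReal_injective (by push_cast; exact h5)
  rw [vNE, dif_pos h, Real.logb]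
  congr 1
  rw [← one_mul (Real.log k), ← sum_eig h ht, Finset.sum_mul]
  refine Finset.sum_congr rfl fun i _ => ?_
  by_cases h0 : h.eigenvalues i = 0
  · simp [h0]
  · have := mul_right_cancel₀ h0 (key i)
    rw [this, Real.negMulLog, Real.log_inv]; ring

lemma vNE_mm_s10 {n : Type*} [Fintype n] [DecidableEq n] [Nonempty n] :
    vNE (mmState n) = Real.logb 2 (Fintype.card n) := by
  apply vNE_flat
  · rw [mmState, Matrix.smul_one_eq_diagonal]
    apply Matrix.isHermitian_diagonal_of_self_adjoint
    ext i; simp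
  · simp [mmState]
  · simp [mmState]

def psiMat {X Y : Type*} (ψ : X × Y → ℂ) : Matrix X Y ℂ := Matrix.of fun x y => ψ (x, y)

lemma redDM_eq {X Y : Type*} [Fintype Y] (ψ : X × Y → ℂ) :
    redDM ψ = psiMat ψ * (psiMat ψ)ᴴ := by
  ext x x'
  simp [redDM, psiMat, Matrix.mul_apply]

lemma redDM_psd {X Y : Type*} [Fintype X] [Fintype Y] (ψ : X × Y → ℂ) : (redDM ψ).PosSemidef := by
  rw [redDM_eq]; exact Matrix.posSemidef_self_mul_conjTranspose _

lemma redDM_rank {X Y : Type*} [Fintype X] [Fintype Y] (ψ : X × Y → ℂ) :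
    (redDM ψ).rank ≤ Fintype.card Y := by
  rw [redDM_eq]
  exact (Matrix.rank_mul_le_left _ _).trans (Matrix.rank_le_card_width _)

lemma redDM_trace {X Y : Type*} [Fintype X] [Fintype Y] (ψ : X × Y → ℂ) :
    (redDM ψ).trace = ∑ p, ψ p * star (ψ p) := by
  simp [redDM, Matrix.trace, Fintype.sum_prod_type]

lemma redDM_sq {X Y : Type*} [Fintype X] [Fintype Y] [DecidableEq Y] (ψ : X × Y → ℂ) (k : ℂ)
    (h : (psiMat ψ)ᴴ * psiMat ψ = k • 1) : redDM ψ * redDM ψ = k • redDM ψ := by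
  rw [redDM_eq, Matrix.mul_assoc, ← Matrix.mul_assoc (psiMat ψ)ᴴ, h]
  simp

section
variable {a b c d : ℕ} (U : Matrix (Fin c × Fin d) (Fin a × Fin b) ℂ)

lemma choi_mul (p q : (Fin a × Fin b) × Fin c × Fin d) :
    choiVec U p * star (choiVec U q) =
      ((a : ℂ) * b)⁻¹ * (U p.2 p.1 * star (U q.2 q.1)) := by
  have h : ((Real.sqrt ((a:ℝ) * b) : ℝ) : ℂ) * ((Real.sqrt ((a:ℝ) * b) : ℝ) : ℂ) = (a:ℂ) * b := by
    rw [← Complex.ofReal_mul, Real.mul_self_sqrt (by positivity)]; push_cast; rfl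
  rw [← h, mul_inv]
  simp [choiVec, Fintype.card_fin]
  ring

lemma col_orth (hU : IsUnitaryMat U) (p q : Fin a × Fin b) :
    ∑ r, U r p * star (U r q) = if p = q then 1 else 0 := by
  have := congrFun (congrFun hU.2 q) p
  simp only [Matrix.mul_apply, Matrix.conjTranspose_apply, Matrix.one_apply] at this
  have e : (if p = q then (1:ℂ) else 0) = if q = p then 1 else 0 := by simp only [eq_comm]
  rw [e, ← this]
  exact Finset.sum_congr rfl fun r _ => mul_comm _ _

lemma row_orth (hU : IsUnitaryMat U) (p q : Fin c × Fin d) :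
    ∑ r, U p r * star (U q r) = if p = q then 1 else 0 := by
  have := congrFun (congrFun hU.1 p) q
  simpa only [Matrix.mul_apply, Matrix.conjTranspose_apply, Matrix.one_apply] using this

lemma choi_norm (hU : IsUnitaryMat U) (ha : a ≠ 0) (hb : b ≠ 0) :
    ∑ p, choiVec U p * star (choiVec U p) = 1 := by
  simp only [choi_mul, ← Finset.mul_sum]
  rw [Fintype.sum_prod_type]
  simp only [col_orth U hU]
  simp
  field_simp

lemma rhoA_eq (hU : IsUnitaryMat U) (hb : b ≠ 0) : rhoA (choiVec U) = mmState (Fin a) := by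
  ext x x'
  simp only [rhoA, redDM, Matrix.of_apply, choi_mul, ← Finset.mul_sum]
  rw [Fintype.sum_prod_type]
  simp only [Prod.mk.eta]
  simp only [col_orth U hU]
  simp [mmState, Matrix.one_apply]
  split_ifs <;> (try field_simp) <;> (try simp)

lemma rhoC_eq (hdim : a * b = c * d) (hU : IsUnitaryMat U) (hd : d ≠ 0) :
    rhoC (choiVec U) = mmState (Fin c) := by
  ext x x'
  simp only [rhoC, redDM, Matrix.of_apply, choi_mul, ← Finset.mul_sum]
  have : ∑ y : Fin a × Fin b × Fin d, U (x, y.2.2) (y.1, y.2.1) * star (U (x', y.2.2) (y.1, y.2.1))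
      = ∑ z : Fin d, ∑ r, U (x, z) r * star (U (x', z) r) := by
    refine Eq.trans ?_ Finset.sum_comm
    simp only [Fintype.sum_prod_type]
  rw [this]
  simp only [row_orth U hU]
  have h : (a:ℂ) * b = c * d := by exact_mod_cast hdim
  rw [h]
  simp [mmState, Matrix.one_apply]
  split_ifs <;> (try field_simp) <;> (try simp)

lemma rhoD_eq (hdim : a * b = c * d) (hU : IsUnitaryMat U) (hc : c ≠ 0) :
    rhoD (choiVec U) = mmState (Fin d) := by
  ext x x'
  simp only [rhoD, redDM, Matrix.of_apply, choi_mul, ← Finset.mul_sum]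
  have : ∑ y : Fin a × Fin b × Fin c, U (y.2.2, x) (y.1, y.2.1) * star (U (y.2.2, x') (y.1, y.2.1))
      = ∑ z : Fin c, ∑ r, U (z, x) r * star (U (z, x') r) := by
    refine Eq.trans ?_ Finset.sum_comm
    simp only [Fintype.sum_prod_type]
  rw [this]
  simp only [row_orth U hU]
  have h : (a:ℂ) * b = c * d := by exact_mod_cast hdim
  rw [h]
  simp [mmState, Matrix.one_apply]
  split_ifs <;> (try field_simp) <;> (try simp)

lemma rhoCD_eq (hdim : a * b = c * d) (hU : IsUnitaryMat U) :
    rhoCD (choiVec U) = mmState (Fin c × Fin d) := by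
  ext x x'
  simp only [rhoCD, redDM, Matrix.of_apply, choi_mul, ← Finset.mul_sum]
  simp only [row_orth U hU]
  have h : (a:ℂ) * b = c * d := by exact_mod_cast hdim
  rw [h]
  simp [mmState, Matrix.one_apply]

lemma SACD_eq (hU : IsUnitaryMat U) (ha : a ≠ 0) (hb : b ≠ 0) :
    SACD (choiVec U) = Real.logb 2 b := by
  apply vNE_flat
  · exact (redDM_psd _).1
  · rw [rhoACD, redDM_trace, ← choi_norm U hU ha hb]
    refine Fintype.sum_equiv
      ⟨fun p => ((p.1.1, p.2), p.1.2), fun p => ((p.1.1, p.2), p.1.2), fun _ => rfl, fun _ => rfl⟩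
      _ _ fun p => rfl
  · apply redDM_sq
    ext y y'
    simp only [psiMat, Matrix.mul_apply, Matrix.conjTranspose_apply, Matrix.of_apply]
    simp only [mul_comm (star _), choi_mul, ← Finset.mul_sum]
    rw [Fintype.sum_prod_type]
    simp only [col_orth U hU]
    simp [Matrix.one_apply, eq_comm]
    split_ifs <;> (try field_simp) <;> (try simp)

end

/-- If `U_{AB→CD}` is maximally I₃-scrambling and `A` or `C` has the
smallest dimension, then `ρ_{AC}` is maximally mixed, `I(A;C) = 0`, and the residual
channel `N_{A→C}(σ) = tr_D[U(σ ⊗ τ_B)Uᴴ]` is completely depolarizing. -/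
theorem maximal_scrambling_depolarizes (a b c d : ℕ) (hdim : a * b = c * d)
    (U : Matrix (Fin c × Fin d) (Fin a × Fin b) ℂ) (hU : IsUnitaryMat U)
    (hsmall : (a ≤ b ∧ a ≤ c ∧ a ≤ d) ∨ (c ≤ a ∧ c ≤ b ∧ c ≤ d))
    (hmax : I3ACD (choiVec U) = -2 * Real.logb 2 (min (min a b) (min c d))) :
    rhoAC (choiVec U) = mmState (Fin a × Fin c) ∧
    IAC (choiVec U) = 0 ∧
    ∀ σ : Matrix (Fin a) (Fin a) ℂ, IsDensityMatrix σ →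
      residual U σ = mmState (Fin c) := by
  by_cases h0 : a = 0 ∨ c = 0
  · have hv : ∀ n : ℕ, vNE (0 : Matrix (Fin n) (Fin n) ℂ) = 0 := by
      intro n
      have hz : (Matrix.isHermitian_zero : (0 : Matrix (Fin n) (Fin n) ℂ).IsHermitian).eigenvalues = 0 :=
        Matrix.IsHermitian.eigenvalues_eq_zero_iff _ |>.2 rfl
      rw [vNE, dif_pos Matrix.isHermitian_zero, hz]
      simp
    have hA : rhoA (choiVec U) = 0 := by
      rcases h0 with rfl | rfl <;> ext i j
      · exact i.elim0
      · simp [rhoA, redDM]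
    have hC : rhoC (choiVec U) = 0 := by
      rcases h0 with rfl | rfl <;> ext i j
      · simp [rhoC, redDM]
      · exact i.elim0
    have he : IsEmpty (Fin a × Fin c) := by
      rcases h0 with rfl | rfl <;> infer_instance
    refine ⟨Subsingleton.elim _ _, ?_, ?_⟩
    · have : SAC (choiVec U) = 0 := by
        rw [SAC, rhoAC, vNE, dif_pos (redDM_psd _).1]
        simp
      rw [IAC, this, SA, SC, hA, hC, hv, hv]; simp
    · intro σ hσ
      rcases h0 with rfl | rfl
      · have := hσ.2
        simp [Matrix.trace] at this
      · exact Subsingleton.elim _ _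
  push Not at h0
  obtain ⟨ha, hc⟩ := h0
  have hb : b ≠ 0 := by omega
  have hd : d ≠ 0 := by omega
  have : NeZero a := ⟨ha⟩
  have : NeZero b := ⟨hb⟩
  have : NeZero c := ⟨hc⟩
  have : NeZero d := ⟨hd⟩
  have eA : SA (choiVec U) = Real.logb 2 a := by
    rw [SA, rhoA_eq U hU hb, vNE_mm_s10, Fintype.card_fin]
  have eC : SC (choiVec U) = Real.logb 2 c := by
    rw [SC, rhoC_eq U hdim hU hd, vNE_mm_s10, Fintype.card_fin]
  have eD : SD (choiVec U) = Real.logb 2 d := by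
    rw [SD, rhoD_eq U hdim hU hc, vNE_mm_s10, Fintype.card_fin]
  have ha' : (a:ℝ) ≠ 0 := by exact_mod_cast ha
  have hb' : (b:ℝ) ≠ 0 := by exact_mod_cast hb
  have hc' : (c:ℝ) ≠ 0 := by exact_mod_cast hc
  have hd' : (d:ℝ) ≠ 0 := by exact_mod_cast hd
  have eCD : SCD (choiVec U) = Real.logb 2 c + Real.logb 2 d := by
    rw [SCD, rhoCD_eq U hdim hU, vNE_mm_s10, Fintype.card_prod, Fintype.card_fin, Fintype.card_fin,
      Nat.cast_mul, Real.logb_mul hc' hd']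
  have eACD := SACD_eq U hU ha hb
  have tAC : (rhoAC (choiVec U)).trace = 1 := by
    rw [rhoAC, redDM_trace, ← choi_norm U hU ha hb]
    refine Fintype.sum_equiv
      ⟨fun p => ((p.1.1, p.2.1), (p.1.2, p.2.2)), fun p => ((p.1.1, p.2.1), (p.1.2, p.2.2)),
        fun _ => rfl, fun _ => rfl⟩ _ _ fun p => rfl
  have tAD : (rhoAD (choiVec U)).trace = 1 := by
    rw [rhoAD, redDM_trace, ← choi_norm U hU ha hb]
    refine Fintype.sum_equiv
      ⟨fun p => ((p.1.1, p.2.1), (p.2.2, p.1.2)), fun p => ((p.1.1, p.2.2), (p.1.2, p.2.1)),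
        fun _ => rfl, fun _ => rfl⟩ _ _ fun p => rfl
  have hlog : Real.logb 2 a + Real.logb 2 b = Real.logb 2 c + Real.logb 2 d := by
    rw [← Real.logb_mul ha' hb', ← Real.logb_mul hc' hd']
    congr 1; exact_mod_cast hdim
  have lAD1 : SAD (choiVec U) ≤ Real.logb 2 a + Real.logb 2 d := by
    have := vNE_le (redDM_psd _) tAD (a * d) (by positivity)
      ((Matrix.rank_le_card_width _).trans (by simp))
    rwa [Nat.cast_mul, Real.logb_mul ha' hd'] at this
  have lAD2 : SAD (choiVec U) ≤ Real.logb 2 b + Real.logb 2 c := by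
    have := vNE_le (redDM_psd _) tAD (b * c) (by positivity)
      ((redDM_rank _).trans (by simp))
    rwa [Nat.cast_mul, Real.logb_mul hb' hc'] at this
  rw [I3ACD, IAC, IAD, IACD, eA, eC, eD, eCD, eACD] at hmax
  have lAC : Real.logb 2 a + Real.logb 2 c ≤ SAC (choiVec U) := by
    rcases hsmall with ⟨h1, h2, h3⟩ | ⟨h1, h2, h3⟩
    · have : (min (min (a:ℝ) b) (min (c:ℝ) d)) = a := by
        exact_mod_cast (by omega : min (min a b) (min c d) = a)
      rw [this] at hmax
      linarith
    · have : (min (min (a:ℝ) b) (min (c:ℝ) d)) = c := by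
        exact_mod_cast (by omega : min (min a b) (min c d) = c)
      rw [this] at hmax
      linarith
  have hAC : rhoAC (choiVec U) = mmState (Fin a × Fin c) := by
    apply eq_mm_of_vNE (redDM_psd _) tAC
    rw [Fintype.card_prod, Fintype.card_fin, Fintype.card_fin, Nat.cast_mul,
      Real.logb_mul ha' hc']
    exact lAC
  refine ⟨hAC, ?_, ?_⟩
  · rw [IAC, eA, eC, SAC, hAC, vNE_mm_s10, Fintype.card_prod, Fintype.card_fin, Fintype.card_fin,
      Nat.cast_mul, Real.logb_mul ha' hc', sub_self]
  · intro σ hσ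
    ext z z'
    have e1 : residual U σ z z' =
        ∑ x, ∑ x', (a:ℂ) * σ x x' * rhoAC (choiVec U) (x, z) (x', z') := by
      simp only [rhoAC, redDM, Matrix.of_apply, choi_mul, ← Finset.mul_sum]
      simp only [residual, Matrix.of_apply, Matrix.mul_apply, mmState, Matrix.kroneckerMap_apply,
        Matrix.conjTranspose_apply, Fintype.sum_prod_type, Matrix.smul_apply, Matrix.one_apply,
        Finset.sum_mul, Finset.mul_sum]
      simp only [smul_eq_mul, mul_ite, ite_mul, mul_zero, zero_mul, Finset.sum_ite_eq',
        Finset.sum_ite_eq, Finset.mem_univ, if_true]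
      refine Finset.sum_comm.trans (Eq.trans ?_ Finset.sum_comm)
      refine Finset.sum_congr rfl fun x' _ => ?_
      refine Finset.sum_comm.trans (Eq.trans ?_ Finset.sum_comm)
      refine Finset.sum_congr rfl fun y _ => ?_
      refine Finset.sum_comm.trans ?_
      refine Finset.sum_congr rfl fun x _ => Finset.sum_congr rfl fun w _ => ?_
      have h1 : (a:ℂ) ≠ 0 := by exact_mod_cast ha
      have h2 : (b:ℂ) ≠ 0 := by exact_mod_cast hb
      simp only [Fintype.card_fin]
      field_simp
    rw [e1, hAC]
    have ht := hσ.2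
    simp only [Matrix.trace, Matrix.diag] at ht
    simp only [mmState, Matrix.smul_apply, Matrix.one_apply, Prod.mk.injEq]
    by_cases hz : z = z'
    · simp [hz]
      rw [← Finset.sum_mul, ← Finset.mul_sum, ht]
      have : (a:ℂ) ≠ 0 := by exact_mod_cast ha
      field_simp
    · simp [hz]

end Scrambling

end
end
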